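/- For all integers r ≥ d ≥ 0, one has C_d(r) ≤ 2^{2^d} · r. -/

import Mathlib

/-- The auxiliary functions C_d : ℤ → ℤ, defined by C_0(r) = r and the recursion
C_d(r) = C_{d-1}(C_{d-1}(r - 1) + 3) + r. -/
def Cfun : ℕ → ℤ → ℤ
  | 0, r => r
  | d + 1, r => Cfun d (Cfun d (r - 1) + 3) + r

theorem Cfun_succ_of_affine {d : ℕ} {a b : ℤ} (h : ∀ r, Cfun d r = a * r + b) (r : ℤ) :
    Cfun (d + 1) r = (a ^ 2 + 1) * r + (a * (b + 3 - a) + b) := by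
  rw [Cfun, h, h]
  ring

theorem Cfun_four (r : ℤ) : Cfun 4 r = 677 * r + 428 := by
  have h₀ (r : ℤ) : Cfun 0 r = 1 * r + 0 := by simp [Cfun]
  have h := Cfun_succ_of_affine (Cfun_succ_of_affine (Cfun_succ_of_affine
    (Cfun_succ_of_affine h₀))) r
  norm_num at h
  exact h

/-- From `d = 5` on, `C_d` is an affine function with nonpositive constant term and slope
strictly below `2 ^ 2 ^ d`. -/
theorem Cfun_eq_affine (k : ℕ) :
    ∃ a b : ℤ, 3 ≤ a ∧ a + 1 ≤ 2 ^ 2 ^ (k + 5) ∧ b ≤ 0 ∧ ∀ r, Cfun (k + 5) r = a * r + b := by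
  induction k with
  | zero =>
    refine ⟨458330, -166114, by norm_num, by norm_num, by norm_num, fun r => ?_⟩
    rw [Cfun_succ_of_affine Cfun_four]
    norm_num
  | succ k ih =>
    obtain ⟨a, b, ha, hX, hb, hC⟩ := ih
    refine ⟨a ^ 2 + 1, a * (b + 3 - a) + b, by nlinarith, ?_, by nlinarith,
      Cfun_succ_of_affine hC⟩
    rw [show k + 1 + 5 = (k + 5) + 1 by ring, pow_succ 2 (k + 5), pow_mul]
    nlinarith

/-- For all integers r ≥ d ≥ 0, C_d(r) ≤ 2^(2^d) · r. -/
theorem Cfun_le (d : ℕ) (r : ℤ) (h : (d : ℤ) ≤ r) :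
    Cfun d r ≤ 2 ^ 2 ^ d * r := by
  obtain hd | hd := lt_or_ge d 5
  · interval_cases d <;> norm_num [Cfun] at h ⊢ <;> linarith
  · obtain ⟨k, rfl⟩ := Nat.exists_eq_add_of_le' hd
    obtain ⟨a, b, -, hX, hb, hC⟩ := Cfun_eq_affine k
    have hr : 0 ≤ r := (Int.natCast_nonneg _).trans h
    rw [hC]
    nlinarith [mul_nonneg (show (0 : ℤ) ≤ 2 ^ 2 ^ (k + 5) - a by linarith) hr]
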